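/- Let H be a finite group and I an infinite index set, and let G be the reduced product: the subgroup of the direct product H^I consisting of those h = (h_i)_{i∈I} with h_i ≠ e_H for only finitely many i ∈ I. Then G is an infinite FC group, x^n y = y x^n holds for all x, y ∈ G with n = |H|, and consequently G does not admit a DTC ultrafilter. -/

import Mathlib

open scoped Pointwise

/-- The product `u ⋄ v` on ultrafilters: `A ∈ u ⋄ v ↔ {x | x⁻¹A ∈ v} ∈ u`. -/
def dprod {G : Type*} [Group G] (u v : Ultrafilter G) : Ultrafilter G :=
  u.bind fun x => v.map fun y => x * y

/-- The product `u ∘ v` on ultrafilters: `A ∈ u ∘ v ↔ {x | Ax⁻¹ ∈ u} ∈ v`. -/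
def cprod {G : Type*} [Group G] (u v : Ultrafilter G) : Ultrafilter G :=
  v.bind fun y => u.map fun x => x * y

/-- Membership characterization of `u ⋄ v`: here `{y | x * y ∈ A}` is the set `x⁻¹A`. -/
theorem mem_dprod {G : Type*} [Group G] (u v : Ultrafilter G) (A : Set G) :
    A ∈ dprod u v ↔ {x : G | {y : G | x * y ∈ A} ∈ v} ∈ u := Iff.rfl

/-- Membership characterization of `u ∘ v`: here `{x | x * y ∈ A}` is the set `Ay⁻¹`. -/
theorem mem_cprod {G : Type*} [Group G] (u v : Ultrafilter G) (A : Set G) :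
    A ∈ cprod u v ↔ {y : G | {x : G | x * y ∈ A} ∈ u} ∈ v := Iff.rfl

/-- `u ∈ βG` is principal, i.e. belongs to the copy of `G` inside `βG`. -/
def IsPrincipal {G : Type*} (u : Ultrafilter G) : Prop :=
  ∃ x : G, u = pure x

/-- `v` is a DTC ultrafilter for `βG`: `u ⋄ v ≠ u ∘ v` for every `u ∈ βG \ G`. -/
def IsDTC {G : Type*} [Group G] (v : Ultrafilter G) : Prop :=
  ∀ u : Ultrafilter G, ¬IsPrincipal u → dprod u v ≠ cprod u v


/-- The reduced product of copies of `H` indexed by `I`: the subgroup of `H^I`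
consisting of those `h` with `h i ≠ 1` for only finitely many `i`. -/
def reducedProduct (H : Type*) [Group H] (I : Type*) : Subgroup (I → H) where
  carrier := {h : I → H | {i : I | h i ≠ 1}.Finite}
  one_mem' := by simp
  mul_mem' := by
    intro a b ha hb
    apply Set.Finite.subset (Set.Finite.union ha hb)
    intro i hi
    simp only [Set.mem_setOf_eq, Set.mem_union, Pi.mul_apply] at hi ⊢
    by_contra h
    push_neg at h
    exact hi (by rw [h.1, h.2, one_mul])
  inv_mem' := by
    intro a ha
    apply Set.Finite.subset ha
    intro i hi
    simp only [Set.mem_setOf_eq, Pi.inv_apply, ne_eq, inv_eq_one] at hi ⊢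
    exact hi

theorem dprod_assoc {G : Type*} [Group G] (u v w : Ultrafilter G) :
    dprod (dprod u v) w = dprod u (dprod v w) := by
  ext A
  simp only [mem_dprod, Set.mem_ofPred_eq, mul_assoc]

theorem dprod_pure_eq_cprod {G : Type*} [Group G] (u : Ultrafilter G) (y : G) :
    dprod u (pure y) = cprod u (pure y) := by
  ext A
  simp only [mem_dprod, mem_cprod, Ultrafilter.mem_pure, Set.mem_ofPred_eq]

theorem not_isPrincipal_hyperfilter {G : Type*} [Infinite G] :
    ¬IsPrincipal (Filter.hyperfilter G) := by
  rintro ⟨x, hx⟩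
  have h : ({x} : Set G) ∈ Filter.hyperfilter G := by
    rw [hx]
    exact Set.mem_singleton x
  exact Filter.notMem_hyperfilter_of_finite (Set.finite_singleton x) h

theorem isPrincipal_of_isPrincipal_dprod {G : Type*} [Group G] {u v : Ultrafilter G}
    (h : IsPrincipal (dprod u v)) : IsPrincipal v := by
  obtain ⟨a, ha⟩ := h
  have hmem : ({a} : Set G) ∈ dprod u v := by
    rw [ha]
    exact Set.mem_singleton a
  obtain ⟨x, hx⟩ := u.nonempty_of_mem ((mem_dprod u v _).1 hmem)
  refine ⟨x⁻¹ * a, Ultrafilter.eq_of_le ?_⟩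
  rw [Ultrafilter.coe_pure, Filter.le_pure_iff]
  refine Filter.mem_of_superset hx fun y hy => ?_
  rw [Set.mem_singleton_iff, eq_inv_mul_iff_mul_eq]
  exact hy

/-- The powers of an ultrafilter with respect to `⋄`. -/
def dpow {G : Type*} [Group G] (v : Ultrafilter G) : ℕ → Ultrafilter G
  | 0 => pure 1
  | k + 1 => dprod v (dpow v k)

theorem dprod_dpow_comm {G : Type*} [Group G] (v : Ultrafilter G) (k : ℕ) :
    dprod (dpow v k) v = dprod v (dpow v k) := by
  induction k with
  | zero =>
    ext A
    simp only [dpow, mem_dprod, Ultrafilter.mem_pure, Set.mem_ofPred_eq, one_mul, mul_one,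
      Set.ofPred_mem_eq]
  | succ k ih => rw [dpow, dprod_assoc, ih]

theorem not_isPrincipal_dpow_succ {G : Type*} [Group G] {v : Ultrafilter G}
    (hv : ¬IsPrincipal v) (k : ℕ) : ¬IsPrincipal (dpow v (k + 1)) := by
  rw [dpow, ← dprod_dpow_comm]
  exact fun h => hv (isPrincipal_of_isPrincipal_dprod h)

/-- If `u` asymptotically centralizes every element of `G`, then `u ∘ v = v ⋄ u`. -/
theorem cprod_eq_dprod_swap {G : Type*} [Group G] {u : Ultrafilter G} (v : Ultrafilter G)
    (hu : ∀ y : G, ∀ᶠ x in u, x * y = y * x) : cprod u v = dprod v u := by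
  ext A
  rw [mem_cprod, mem_dprod]
  have h : {y : G | {x : G | x * y ∈ A} ∈ u} = {y : G | {x : G | y * x ∈ A} ∈ u} := by
    ext y
    exact Filter.eventually_congr ((hu y).mono fun x hx => by rw [hx])
  rw [h]

/-- In an FC group, conjugation along an ultrafilter agrees on the conjugacy class of `y` with
conjugation by a single element. -/
theorem exists_eventually_conj_eq {G : Type*} [Group G] (v : Ultrafilter G) (y : G)
    (hy : {z : G | ∃ x : G, x⁻¹ * y * x = z}.Finite) :
    ∃ g : G, ∀ᶠ x in v, ∀ z ∈ {z : G | ∃ x : G, x⁻¹ * y * x = z},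
      x * z * x⁻¹ = g * z * g⁻¹ := by
  set S := {z : G | ∃ x : G, x⁻¹ * y * x = z} with hS
  have hlim : ∀ z ∈ S, ∃ w : G, ∀ᶠ x in v, x * z * x⁻¹ = w := by
    rintro z ⟨a, rfl⟩
    have hmem : (⋃ w ∈ S, {x : G | x * (a⁻¹ * y * a) * x⁻¹ = w}) ∈ v := by
      refine Filter.mem_of_superset Filter.univ_mem fun x _ => ?_
      simp only [Set.mem_iUnion, Set.mem_ofPred_eq, exists_prop]
      exact ⟨_, ⟨a * x⁻¹, by group⟩, rfl⟩
    obtain ⟨w, -, hw⟩ := (Ultrafilter.finite_biUnion_mem_iff hy).1 hmem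
    exact ⟨w, hw⟩
  choose! w hw using hlim
  have hall : ∀ᶠ x in v, ∀ z ∈ S, x * z * x⁻¹ = w z :=
    (Filter.eventually_all_finite hy).2 hw
  obtain ⟨g, hg⟩ := hall.exists
  exact ⟨g, hall.mono fun x hx z hz => (hx z hz).trans (hg z hz).symm⟩

/-- In an FC group whose `n`-th powers are central, the `n`-th `⋄`-power of any ultrafilter
asymptotically centralizes every element. -/
theorem eventually_dpow_commute {G : Type*} [Group G]
    (hFC : ∀ y : G, {z : G | ∃ x : G, x⁻¹ * y * x = z}.Finite) {n : ℕ}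
    (hn : ∀ x y : G, x ^ n * y = y * x ^ n) (v : Ultrafilter G) (y : G) :
    ∀ᶠ x in dpow v n, x * y = y * x := by
  obtain ⟨g, hg⟩ := exists_eventually_conj_eq v y (hFC y)
  have hpow : ∀ k : ℕ, ∀ᶠ x in dpow v k, x * y * x⁻¹ = g ^ k * y * (g ^ k)⁻¹ := by
    intro k
    induction k with
    | zero =>
      change (1 : G) * y * 1⁻¹ = g ^ 0 * y * (g ^ 0)⁻¹
      rw [pow_zero]
    | succ k ih =>
      change ∀ᶠ x in v, ∀ᶠ t in dpow v k,
        x * t * y * (x * t)⁻¹ = g ^ (k + 1) * y * (g ^ (k + 1))⁻¹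
      filter_upwards [hg] with x hx
      filter_upwards [ih] with t ht
      calc x * t * y * (x * t)⁻¹ = x * (t * y * t⁻¹) * x⁻¹ := by group
        _ = g * (g ^ k * y * (g ^ k)⁻¹) * g⁻¹ := by
          rw [ht]
          exact hx _ ⟨(g ^ k)⁻¹, by rw [inv_inv]⟩
        _ = g ^ (k + 1) * y * (g ^ (k + 1))⁻¹ := by
          rw [pow_succ']
          group
  filter_upwards [hpow n] with x hx
  rwa [hn g y, mul_inv_cancel_right, mul_inv_eq_iff_eq_mul] at hx

/-- An infinite FC group whose `n`-th powers are central for some `n ≠ 0` has no DTC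
ultrafilter. -/
theorem not_exists_isDTC {G : Type*} [Group G] [Infinite G]
    (hFC : ∀ y : G, {z : G | ∃ x : G, x⁻¹ * y * x = z}.Finite) {n : ℕ} (hn0 : n ≠ 0)
    (hn : ∀ x y : G, x ^ n * y = y * x ^ n) : ¬∃ v : Ultrafilter G, IsDTC v := by
  rintro ⟨v, hv⟩
  by_cases hp : IsPrincipal v
  · obtain ⟨y, rfl⟩ := hp
    exact hv _ not_isPrincipal_hyperfilter (dprod_pure_eq_cprod _ y)
  · obtain ⟨k, rfl⟩ := Nat.exists_eq_succ_of_ne_zero hn0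
    refine hv _ (not_isPrincipal_dpow_succ hp k) ?_
    rw [cprod_eq_dprod_swap v (eventually_dpow_commute hFC hn v), dprod_dpow_comm]

theorem infinite_reducedProduct (H : Type*) [Group H] [Nontrivial H] (I : Type*) [Infinite I] :
    Infinite (reducedProduct H I) := by
  classical
  obtain ⟨h, hh⟩ := exists_ne (1 : H)
  have hmem : ∀ i : I, (Pi.mulSingle i h : I → H) ∈ reducedProduct H I := fun i =>
    (Set.finite_singleton i).subset fun j hj => by
      by_contra hne
      exact hj (Pi.mulSingle_eq_of_ne (M := fun _ => H) hne h)
  refine Infinite.of_injective (fun i : I => (⟨Pi.mulSingle i h, hmem i⟩ : reducedProduct H I))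
    fun i j hij => ?_
  by_contra hne
  have hval := congrFun (congrArg Subtype.val hij) i
  simp only [Pi.mulSingle_eq_same, Pi.mulSingle_eq_of_ne hne] at hval
  exact hh hval

theorem finite_conj_reducedProduct (H : Type*) [Group H] [Finite H] (I : Type*)
    (y : reducedProduct H I) :
    {z : reducedProduct H I | ∃ x : reducedProduct H I, x⁻¹ * y * x = z}.Finite := by
  have hfin : Finite {i : I | y.1 i ≠ 1} := y.2
  refine Set.Finite.of_finite_image
    (f := fun z : reducedProduct H I => fun i : {i : I | y.1 i ≠ 1} => z.1 i)
    (Set.toFinite _) ?_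
  rintro _ ⟨a, rfl⟩ _ ⟨b, rfl⟩ hab
  ext i
  by_cases hi : y.1 i = 1
  · simp [hi]
  · exact congrFun hab ⟨i, hi⟩

theorem reducedProduct_pow_card (H : Type*) [Group H] [Finite H] (I : Type*)
    (x : reducedProduct H I) : x ^ Nat.card H = 1 := by
  ext i
  simp [pow_card_eq_one']

/-- For a finite (nontrivial) group `H` and an infinite index set `I`, the reduced
product `G ⊆ H^I` is an infinite FC group, satisfies `xⁿy = yxⁿ` for all `x, y ∈ G`
with `n = |H|`, and consequently admits no DTC ultrafilter. -/
theorem reduced_product_no_dtc (H : Type*) [Group H] [Finite H] [Nontrivial H]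
    (I : Type*) [Infinite I] :
    Infinite ↥(reducedProduct H I) ∧
    (∀ y : ↥(reducedProduct H I),
      {z : ↥(reducedProduct H I) | ∃ x : ↥(reducedProduct H I), x⁻¹ * y * x = z}.Finite) ∧
    (∀ x y : ↥(reducedProduct H I),
      x ^ (Nat.card H) * y = y * x ^ (Nat.card H)) ∧
    ¬∃ v : Ultrafilter ↥(reducedProduct H I), IsDTC v := by
  have hpow : ∀ x y : reducedProduct H I, x ^ Nat.card H * y = y * x ^ Nat.card H := by
    intro x y
    rw [reducedProduct_pow_card, one_mul, mul_one]
  have := infinite_reducedProduct H I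
  exact ⟨this, finite_conj_reducedProduct H I, hpow,
    not_exists_isDTC (finite_conj_reducedProduct H I) Nat.card_pos.ne' hpow⟩
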